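/- Suppose the canonical map can : P ⊗_B P → P ⊗ H is surjective, N_P is a P-subbimodule of Ω¹P, and V is a vector subspace of H⁺ satisfying can̄(N_P) ⊆ P ⊗ V. Then the following are equivalent: (1) P is an H-Galois extension of B and P ⊗ V ⊆ can̄(N_P); (2) the sequence of left P-modules 0 → PΩ¹(B)P → Ω¹(P) → P ⊗ (H⁺/V) → 0 (with inclusion followed by χ) is exact, and N_P ∩ Ker(can̄) ⊆ P(Ω¹B)P. -/

import Mathlib

open TensorProduct

noncomputable section

variable (k : Type) [Field k] (P : Type) [Ring P] [Algebra k P]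
variable (H : Type) [Ring H] [HopfAlgebra k H]

/-- The multiplication map `m : P ⊗[k] P → P`, as a map of left `P`-modules
(left `P`-action on `P ⊗[k] P` on the first factor).  Its kernel is the universal
first order differential calculus `Ω¹P`. -/
def mulMap : (P ⊗[k] P) →ₗ[P] P :=
  TensorProduct.AlgebraTensorModule.lift
    { toFun := fun a => a • (LinearMap.id : P →ₗ[k] P)
      map_add' := fun a b => add_smul a b _
      map_smul' := fun p a => by simp [smul_eq_mul, mul_smul] }

@[simp] lemma mulMap_tmul (a b : P) : mulMap k P (a ⊗ₜ[k] b) = a * b := by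
  simp [mulMap]

/-- `Ω¹P`, the universal first order differential calculus on `P`:
the kernel of the multiplication map `P ⊗ P → P`. -/
def omega1 : Submodule P (P ⊗[k] P) := LinearMap.ker (mulMap k P)

/-- The map `(m ⊗ id) ∘ (id ⊗ Δ_R) : P ⊗ P → P ⊗ H` (on pure tensors,
`p ⊗ p' ↦ (p ⊗ 1) · Δ_R p'`), as a map of left `P`-modules.  The map `can̄` of the
paper is its restriction to `Ω¹P`. -/
def betaMap (Δ : P →ₐ[k] P ⊗[k] H) : (P ⊗[k] P) →ₗ[P] (P ⊗[k] H) :=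
  TensorProduct.AlgebraTensorModule.lift
    { toFun := fun a => a • Δ.toLinearMap
      map_add' := fun a b => add_smul a b _
      map_smul' := fun p a => by simp [smul_eq_mul, mul_smul] }

@[simp] lemma betaMap_tmul (Δ : P →ₐ[k] P ⊗[k] H) (a b : P) :
    betaMap k P H Δ (a ⊗ₜ[k] b) = a • (Δ b) := by
  simp [betaMap]

set_option synthInstance.maxHeartbeats 1000000 in
/-- `betaMap` is indeed `(m ⊗ id) ∘ (assoc)⁻¹ ∘ (id ⊗ Δ_R)`. -/
lemma betaMap_eq (Δ : P →ₐ[k] P ⊗[k] H) (x : P ⊗[k] P) :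
    betaMap k P H Δ x =
      ((TensorProduct.map (LinearMap.mul' k P) LinearMap.id) ∘ₗ
        (TensorProduct.assoc k P P H).symm.toLinearMap ∘ₗ
          (TensorProduct.map LinearMap.id Δ.toLinearMap)) x := by
  simp only [LinearMap.comp_apply, LinearEquiv.coe_coe]
  induction x using TensorProduct.induction_on with
  | zero => simp
  | tmul a b =>
      simp only [betaMap_tmul, TensorProduct.map_tmul, LinearMap.id_coe, id_eq,
        AlgHom.toLinearMap_apply]
      generalize Δ b = t
      induction t using TensorProduct.induction_on with
      | zero => simp
      | tmul x h => simp [TensorProduct.smul_tmul', smul_eq_mul]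
      | add t₁ t₂ h₁ h₂ => simp [tmul_add, smul_add, h₁, h₂]
  | add x y hx hy => simp [hx, hy]

/-- Coassociativity of the coaction `Δ_R` (comodule axiom). -/
def IsCoassoc (Δ : P →ₐ[k] P ⊗[k] H) : Prop :=
  ∀ p : P,
    (TensorProduct.assoc k P H H)
        ((TensorProduct.map Δ.toLinearMap LinearMap.id) (Δ p)) =
      (TensorProduct.map LinearMap.id (Coalgebra.comul (R := k) (A := H))) (Δ p)

/-- Counitality of the coaction `Δ_R` (comodule axiom):
`(id ⊗ ε) ∘ Δ_R = id` (under `P ⊗ k ≅ P`). -/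
def IsCounital (Δ : P →ₐ[k] P ⊗[k] H) : Prop :=
  ∀ p : P,
    (TensorProduct.map (LinearMap.id : P →ₗ[k] P) (Coalgebra.counit (R := k) (A := H)))
        (Δ p) = p ⊗ₜ[k] (1 : k)

/-- The set of coinvariants `B := P^{co H} = {p | Δ_R p = p ⊗ 1}`. -/
def coinv (Δ : P →ₐ[k] P ⊗[k] H) : Set P := {b | Δ b = b ⊗ₜ[k] (1 : H)}

/-- `P(Ω¹B)P ⊆ Ω¹P`: the `P`-subbimodule of `Ω¹P` generated by `Ω¹B`, i.e. the span of
the elements `p(1 ⊗ b - b ⊗ 1)p' = p ⊗ (b p') - (p b) ⊗ p'` with `b ∈ B = P^{co H}`,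
`p, p' ∈ P`.  This is also the subspace of relations defining `P ⊗_B P`. -/
def POmega1BP (Δ : P →ₐ[k] P ⊗[k] H) : Submodule P (P ⊗[k] P) :=
  Submodule.span P
    {x | ∃ b p', b ∈ coinv k P H Δ ∧ x = (1 : P) ⊗ₜ[k] (b * p') - b ⊗ₜ[k] p'}

/-- `H⁺ := Ker ε`, the augmentation ideal of `H`. -/
def hPlus : Submodule k H := LinearMap.ker (Coalgebra.counit (R := k) (A := H))

/-- For a subspace `V ⊆ H`, the subspace `P ⊗ V` of `P ⊗ H`. -/
def ptensor (V : Submodule k H) : Submodule P (P ⊗[k] H) :=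
  Submodule.span P {x | ∃ v ∈ V, x = (1 : P) ⊗ₜ[k] v}

/-- `P(Ω¹B)P` is contained in the kernel of `(m ⊗ id) ∘ (id ⊗ Δ_R)`. -/
lemma POmega1BP_le_ker (Δ : P →ₐ[k] P ⊗[k] H) :
    POmega1BP k P H Δ ≤ LinearMap.ker (betaMap k P H Δ) := by
  rw [POmega1BP, Submodule.span_le]
  rintro x ⟨b, p', hb, rfl⟩
  have hone : ∀ t : P ⊗[k] H, (b ⊗ₜ[k] (1 : H)) * t = b • t := by
    intro t
    induction t using TensorProduct.induction_on with
    | zero => simp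
    | tmul x h => simp [Algebra.TensorProduct.tmul_mul_tmul, TensorProduct.smul_tmul', smul_eq_mul]
    | add t₁ t₂ h₁ h₂ => simp [mul_add, smul_add, h₁, h₂]
  have hmem : Δ b = b ⊗ₜ[k] (1 : H) := hb
  simp only [SetLike.mem_coe, LinearMap.mem_ker, map_sub, betaMap_tmul, one_smul,
    map_mul, hmem, hone, sub_self]

/-- The canonical map `can : P ⊗_B P → P ⊗ H`, where `P ⊗_B P` is realized as the
quotient of `P ⊗[k] P` by the relation subspace. -/
def canMap (Δ : P →ₐ[k] P ⊗[k] H) :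
    ((P ⊗[k] P) ⧸ POmega1BP k P H Δ) →ₗ[P] (P ⊗[k] H) :=
  Submodule.liftQ _ (betaMap k P H Δ) (POmega1BP_le_ker k P H Δ)

/-- `P` is an `H`-Galois extension of `B := P^{co H}` iff the canonical map
`can : P ⊗_B P → P ⊗ H` is bijective. -/
def IsGaloisExtension (Δ : P →ₐ[k] P ⊗[k] H) : Prop :=
  Function.Bijective (canMap k P H Δ)

/-- The induced map `χ : Ω¹(P) = Ω¹P/N_P → P ⊗ (H⁺/V)`, where the codomain is realized
inside `(P ⊗ H)/(P ⊗ V)`; `χ` satisfies `χ ∘ π_P = (id ⊗ π_H) ∘ can̄`. -/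
def chiMap (Δ : P →ₐ[k] P ⊗[k] H) (N : Submodule P (P ⊗[k] P)) (V : Submodule k H)
    (hcompat : Submodule.map (betaMap k P H Δ) N ≤ ptensor k P H V) :
    ((↥(omega1 k P)) ⧸ N.comap (omega1 k P).subtype) →ₗ[P]
      ((P ⊗[k] H) ⧸ ptensor k P H V) :=
  Submodule.liftQ _
    ((ptensor k P H V).mkQ ∘ₗ (betaMap k P H Δ) ∘ₗ (omega1 k P).subtype)
    (by
      intro x hx
      have hx' : (x : P ⊗[k] P) ∈ N := hx
      simp only [LinearMap.mem_ker, LinearMap.comp_apply, Submodule.subtype_apply,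
        Submodule.mkQ_apply, Submodule.Quotient.mk_eq_zero]
      exact hcompat (Submodule.mem_map.mpr ⟨(x : P ⊗[k] P), hx', rfl⟩))


/-- `id ⊗ ε : P ⊗ H → P`, as a map of left `P`-modules. -/
def epsMap : (P ⊗[k] H) →ₗ[P] P :=
  (TensorProduct.AlgebraTensorModule.rid k P P).toLinearMap ∘ₗ
    TensorProduct.AlgebraTensorModule.map (LinearMap.id : P →ₗ[P] P)
      (Coalgebra.counit (R := k) (A := H))

lemma epsMap_betaMap (Δ : P →ₐ[k] P ⊗[k] H) (hcu : IsCounital k P H Δ) (x : P ⊗[k] P) :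
    epsMap k P H (betaMap k P H Δ x) = mulMap k P x := by
  induction x using TensorProduct.induction_on with
  | zero => simp
  | tmul a b =>
      have h : epsMap k P H (Δ b) = b := by
        have h2 : epsMap k P H (Δ b) = TensorProduct.AlgebraTensorModule.rid k P P
          ((TensorProduct.map (LinearMap.id : P →ₗ[k] P)
            (Coalgebra.counit (R := k) (A := H))) (Δ b)) := rfl
        rw [h2, hcu b]
        simp
      rw [betaMap_tmul, map_smul, h, mulMap_tmul, smul_eq_mul]
  | add x y hx hy => simp only [map_add, hx, hy]

lemma mem_ptensor_hPlus (t : P ⊗[k] H) :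
    t ∈ ptensor k P H (hPlus k H) ↔ epsMap k P H t = 0 := by
  constructor
  · intro ht
    have : ptensor k P H (hPlus k H) ≤ LinearMap.ker (epsMap k P H) := by
      rw [ptensor, Submodule.span_le]
      rintro x ⟨v, hv, rfl⟩
      have hv' : Coalgebra.counit (R := k) (A := H) v = 0 := hv
      simp [epsMap, hv']
    exact this ht
  · intro ht
    have key : ∀ t : P ⊗[k] H,
        t - (epsMap k P H t) ⊗ₜ[k] (1 : H) ∈ ptensor k P H (hPlus k H) := by
      intro t
      induction t using TensorProduct.induction_on with
      | zero => simp
      | tmul p h =>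
          have h1 : p ⊗ₜ[k] h - (epsMap k P H (p ⊗ₜ[k] h)) ⊗ₜ[k] (1 : H) =
              p • ((1 : P) ⊗ₜ[k] (h - (Coalgebra.counit (R := k) (A := H) h) • (1 : H))) := by
            have h0 : epsMap k P H (p ⊗ₜ[k] h) =
                (Coalgebra.counit (R := k) (A := H) h) • p := by
              simp [epsMap]
            rw [h0, TensorProduct.smul_tmul', smul_eq_mul, mul_one, TensorProduct.tmul_sub,
              TensorProduct.smul_tmul]
          rw [h1]
          refine Submodule.smul_mem _ _ (Submodule.subset_span ⟨_, ?_, rfl⟩)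
          simp [hPlus]
      | add x y hx hy =>
          have h1 : x + y - (epsMap k P H (x + y)) ⊗ₜ[k] (1 : H) =
              (x - (epsMap k P H x) ⊗ₜ[k] (1 : H)) + (y - (epsMap k P H y) ⊗ₜ[k] (1 : H)) := by
            rw [map_add, TensorProduct.add_tmul]; abel
          rw [h1]
          exact Submodule.add_mem _ hx hy
    have := key t
    rwa [ht, TensorProduct.zero_tmul, sub_zero] at this

/-- suppose `can : P ⊗_B P → P ⊗ H` is surjective, `N_P` is a
`P`-subbimodule of `Ω¹P`, and `V ⊆ H⁺` satisfies `can̄(N_P) ⊆ P ⊗ V`.  Then the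
following are equivalent: (1) `P` is an `H`-Galois extension of `B` and
`P ⊗ V ⊆ can̄(N_P)`; (2) the sequence `0 → PΩ¹(B)P → Ω¹(P) → P ⊗ (H⁺/V) → 0` of left
`P`-modules is exact and `N_P ∩ Ker can̄ ⊆ P(Ω¹B)P`. -/
theorem galois_iff_quotient_sequence_exact_of_can_surjective
    (Δ : P →ₐ[k] P ⊗[k] H) (hco : IsCoassoc k P H Δ) (hcu : IsCounital k P H Δ)
    (hcan : Function.Surjective (canMap k P H Δ))
    (N : Submodule P (P ⊗[k] P)) (hN : N ≤ omega1 k P)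
    (hNr : ∀ (p : P), ∀ x ∈ N,
      (TensorProduct.map LinearMap.id (LinearMap.mulRight k p)) x ∈ N)
    (V : Submodule k H) (hV : V ≤ hPlus k H)
    (hcompat : Submodule.map (betaMap k P H Δ) N ≤ ptensor k P H V) :
    (IsGaloisExtension k P H Δ ∧
        ptensor k P H V ≤ Submodule.map (betaMap k P H Δ) N) ↔
      (LinearMap.ker (chiMap k P H Δ N V hcompat) =
          Submodule.map (N.comap (omega1 k P).subtype).mkQ
            ((POmega1BP k P H Δ).comap (omega1 k P).subtype) ∧
        LinearMap.range (chiMap k P H Δ N V hcompat) =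
          Submodule.map (ptensor k P H V).mkQ (ptensor k P H (hPlus k H)) ∧
        N ⊓ LinearMap.ker (betaMap k P H Δ) ≤ POmega1BP k P H Δ) := by
  have hom : ∀ x : P ⊗[k] P, x ∈ omega1 k P ↔
      betaMap k P H Δ x ∈ ptensor k P H (hPlus k H) := by
    intro x
    rw [mem_ptensor_hPlus, epsMap_betaMap k P H Δ hcu]
    exact LinearMap.mem_ker
  have hsurj : Function.Surjective (betaMap k P H Δ) := by
    intro t
    obtain ⟨q, hq⟩ := hcan t
    obtain ⟨x, rfl⟩ := Submodule.Quotient.mk_surjective _ q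
    exact ⟨x, hq⟩
  have hker : ∀ x ∈ POmega1BP k P H Δ, betaMap k P H Δ x = 0 :=
    fun x hx => POmega1BP_le_ker k P H Δ hx
  have hchi : ∀ x : omega1 k P,
      Submodule.Quotient.mk x ∈ LinearMap.ker (chiMap k P H Δ N V hcompat) ↔
        betaMap k P H Δ x ∈ ptensor k P H V := by
    intro x
    rw [LinearMap.mem_ker]
    exact Submodule.Quotient.mk_eq_zero _
  have hVle : ptensor k P H V ≤ ptensor k P H (hPlus k H) := by
    apply Submodule.span_mono
    rintro x ⟨v, hv, rfl⟩
    exact ⟨v, hV hv, rfl⟩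
  constructor
  · rintro ⟨hG, hVN⟩
    have hK : ∀ x, betaMap k P H Δ x = 0 → x ∈ POmega1BP k P H Δ := by
      intro x hx
      rw [← Submodule.Quotient.mk_eq_zero]
      apply hG.1
      rw [map_zero]
      exact hx
    refine ⟨?_, ?_, fun x hx => hK x hx.2⟩
    · ext q
      obtain ⟨x, rfl⟩ := Submodule.Quotient.mk_surjective _ q
      rw [hchi]
      constructor
      · intro hx
        obtain ⟨n, hn, hnx⟩ := hVN hx
        refine ⟨x - ⟨n, hN hn⟩, ?_, ?_⟩
        · refine hK _ ?_
          simp [hnx]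
        · refine (Submodule.Quotient.eq _).2 ?_
          have : x - ⟨n, hN hn⟩ - x = -⟨n, hN hn⟩ := by abel
          rw [this]
          exact Submodule.neg_mem _ hn
      · rintro ⟨y, hy, hyx⟩
        have h1 := (hchi y).2 (by rw [hker (y : P ⊗[k] P) hy]; exact Submodule.zero_mem _)
        rw [← hchi]
        rw [← hyx]
        exact h1
    · ext q
      constructor
      · rintro ⟨y, rfl⟩
        obtain ⟨x, rfl⟩ := Submodule.Quotient.mk_surjective _ y
        exact ⟨betaMap k P H Δ x, (hom x).1 x.2, rfl⟩
      · rintro ⟨t, ht, rfl⟩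
        obtain ⟨x, rfl⟩ := hsurj t
        exact ⟨Submodule.Quotient.mk ⟨x, (hom x).2 ht⟩, rfl⟩
  · rintro ⟨hk, -, hNk⟩
    have dec : ∀ x, betaMap k P H Δ x ∈ ptensor k P H V →
        ∃ y ∈ POmega1BP k P H Δ, ∃ n ∈ N, x = y + n := by
      intro x hx
      have h1 := (hchi ⟨x, (hom x).2 (hVle hx)⟩).2 hx
      rw [hk] at h1
      obtain ⟨y, hy, hyx⟩ := h1
      have h2 := (Submodule.Quotient.eq _).1 hyx.symm
      exact ⟨y, hy, x - y, h2, by abel⟩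
    refine ⟨⟨?_, hcan⟩, ?_⟩
    · rw [injective_iff_map_eq_zero]
      intro q hq
      obtain ⟨x, rfl⟩ := Submodule.Quotient.mk_surjective _ q
      have hx : betaMap k P H Δ x = 0 := hq
      rw [Submodule.Quotient.mk_eq_zero]
      obtain ⟨y, hy, n, hn, rfl⟩ := dec x (by rw [hx]; exact Submodule.zero_mem _)
      rw [map_add, hker y hy, zero_add] at hx
      exact Submodule.add_mem _ hy (hNk ⟨hn, hx⟩)
    · intro t ht
      obtain ⟨x, rfl⟩ := hsurj t
      obtain ⟨y, hy, n, hn, rfl⟩ := dec x ht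
      exact ⟨n, hn, by rw [map_add, hker y hy, zero_add]⟩

end
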